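/- arXiv:2003.06072 — 7 statements merged into one kernel-verified Lean document; each statement's English description precedes it below -/
import Mathlib

section
/- For every finite group G, one has α(G) ≤ α(Z(G)), where Z(G) denotes the center of G. -/
/-- `α(G) = |C(G)| / |G|`, where `C(G)` is the set of cyclic subgroups of `G`. -/
noncomputable def alpha (G : Type*) [Group G] : ℚ :=
  (Nat.card {H : Subgroup G // IsCyclic H} : ℚ) / (Nat.card G : ℚ)

open Finset in
/-- Counting each cyclic subgroup through its generators. -/
theorem card_isCyclic_subgroup_eq_sum (G : Type*) [Group G] [Fintype G] :
    (Nat.card {H : Subgroup G // IsCyclic H} : ℚ) =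
      ∑ x : G, (1 : ℚ) / (Nat.totient (orderOf x) : ℚ) := by
  classical
  have : Fintype {H : Subgroup G // IsCyclic H} := Fintype.ofFinite _
  let gen : G → {H : Subgroup G // IsCyclic H} :=
    fun x => ⟨Subgroup.zpowers x, inferInstance⟩
  have key : ∀ H : {H : Subgroup G // IsCyclic H},
      ∑ x with gen x = H, (1 : ℚ) / (Nat.totient (orderOf x) : ℚ) = 1 := by
    rintro ⟨H, hH⟩
    have hord : ∀ x ∈ (univ : Finset G).filter (fun x => gen x = ⟨H, hH⟩),
        (1 : ℚ) / (Nat.totient (orderOf x) : ℚ) = 1 / (Nat.totient (Nat.card H) : ℚ) := by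
      intro x hx
      have hx : Subgroup.zpowers x = H := congrArg Subtype.val (mem_filter.1 hx).2
      rw [← hx, Nat.card_zpowers]
    have hcard : #{x | gen x = ⟨H, hH⟩} = Nat.totient (Nat.card H) := by
      rw [Nat.card_eq_fintype_card, ← IsCyclic.card_orderOf_eq_totient (α := H) dvd_rfl]
      symm
      refine card_bij (fun x _ => (x : G)) ?_ (fun _ _ _ _ h => Subtype.ext h) ?_
      · intro x hx
        have hx : orderOf x = Fintype.card H := (mem_filter.1 hx).2
        refine mem_filter.2 ⟨mem_univ _, Subtype.ext ?_⟩
        refine Subgroup.eq_of_le_of_card_ge (Subgroup.zpowers_le.2 x.2) ?_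
        rw [Nat.card_zpowers, Subgroup.orderOf_coe, hx, Nat.card_eq_fintype_card]
      · intro x hx
        have hx : Subgroup.zpowers x = H := congrArg Subtype.val (mem_filter.1 hx).2
        refine ⟨⟨x, hx ▸ Subgroup.mem_zpowers x⟩, mem_filter.2 ⟨mem_univ _, ?_⟩, rfl⟩
        rw [Subgroup.orderOf_mk, ← Nat.card_eq_fintype_card, ← hx, Nat.card_zpowers]
    have hpos : (Nat.totient (Nat.card H) : ℚ) ≠ 0 := by
      exact_mod_cast (Nat.totient_pos.2 Nat.card_pos).ne'
    rw [sum_congr rfl hord, sum_const, hcard, nsmul_eq_mul, mul_one_div_cancel hpos]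
  rw [← sum_fiberwise univ gen, sum_congr rfl fun H _ => key H]
  simp

theorem Nat.Prime.pow_dvd_lcm {p k a b : ℕ} (hp : p.Prime) (ha : a ≠ 0) (hb : b ≠ 0) :
    p ^ k ∣ Nat.lcm a b ↔ p ^ k ∣ a ∨ p ^ k ∣ b := by
  rw [hp.pow_dvd_iff_le_factorization (Nat.lcm_ne_zero ha hb),
    hp.pow_dvd_iff_le_factorization ha, hp.pow_dvd_iff_le_factorization hb,
    Nat.factorization_lcm ha hb, Finsupp.sup_apply, le_sup_iff]

/-- If `g` has minimal order in the coset `gH` of a central subgroup `H`, then multiplying an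
element of `H` by `g` can only enlarge its order, in the sense of divisibility. -/
theorem orderOf_dvd_orderOf_mul_of_minimal {G : Type*} [Group G] [Finite G] {H : Subgroup G}
    (hH : H ≤ Subgroup.center G) {g : G} (hg : ∀ w ∈ H, orderOf g ≤ orderOf (g * w))
    {z : G} (hz : z ∈ H) : orderOf z ∣ orderOf (g * z) := by
  have comm : ∀ w ∈ H, Commute g w := fun w hw => Subgroup.mem_center_iff.1 (hH hw) g
  set m := orderOf (g * z) with hm
  have hm0 : m ≠ 0 := (orderOf_pos _).ne'
  have hn0 : orderOf g ≠ 0 := (orderOf_pos _).ne'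
  have hz0 : orderOf z ≠ 0 := (orderOf_pos _).ne'
  by_contra hdvd
  rw [Nat.dvd_iff_prime_pow_dvd_dvd] at hdvd
  push Not at hdvd
  obtain ⟨p, j, hp, hjz, hjm⟩ := hdvd
  obtain ⟨k, s, hps, hks⟩ := Nat.exists_eq_pow_mul_and_not_dvd hz0 p hp.ne_one
  have hcop : Nat.Coprime (p ^ k) s := ((Nat.Prime.coprime_iff_not_dvd hp).2 hps).pow_left k
  have hkm : ¬ p ^ k ∣ m := by
    refine fun h => hjm ((pow_dvd_pow p ?_).trans h)
    rw [hks] at hjz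
    refine (Nat.pow_dvd_pow_iff_le_right hp.one_lt).1 ?_
    exact (((Nat.Prime.coprime_iff_not_dvd hp).2 hps).pow_left j).dvd_of_dvd_mul_right hjz
  have not_dvd_lcm : ∀ b, b ≠ 0 → ¬ p ^ k ∣ b → ¬ p ^ k ∣ Nat.lcm m b := fun b hb0 hb =>
    mt (hp.pow_dvd_lcm hm0 hb0).1 (not_or.2 ⟨hkm, hb⟩)
  have hk0 : k ≠ 0 := by rintro rfl; exact hkm (by simp)
  have hkn : p ^ k ∣ orderOf g := by
    by_contra h
    refine not_dvd_lcm _ hn0 h (Dvd.dvd.trans ⟨s, hks⟩ (orderOf_dvd_of_pow_eq_one ?_))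
    have h1 : (g * z) ^ Nat.lcm m (orderOf g) = 1 :=
      orderOf_dvd_iff_pow_eq_one.1 (Nat.dvd_lcm_left _ _)
    have h2 : g ^ Nat.lcm m (orderOf g) = 1 :=
      orderOf_dvd_iff_pow_eq_one.1 (Nat.dvd_lcm_right _ _)
    rwa [(comm z hz).mul_pow, h2, one_mul] at h1
  obtain ⟨c, hc1, hc0⟩ := Nat.chineseRemainder hcop 1 0
  have hw : z ^ c ∈ H := H.pow_mem hz c
  have hwp : (z ^ c) ^ p ^ k = 1 := by
    rw [← pow_mul]
    refine orderOf_dvd_iff_pow_eq_one.1 ?_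
    rw [hks, mul_comm]
    exact Nat.mul_dvd_mul_right ((Nat.modEq_zero_iff_dvd).1 hc0) _
  have hws : (z ^ c) ^ s = z ^ s := by
    rw [← pow_mul, pow_eq_pow_iff_modEq, hks]
    simpa using hc1.mul_right' s
  have hdvd : orderOf (g * z ^ c) ∣ orderOf g := by
    refine orderOf_dvd_of_pow_eq_one ?_
    obtain ⟨t, ht⟩ := hkn
    rw [(comm _ hw).mul_pow, pow_orderOf_eq_one, one_mul, ht, pow_mul, hwp, one_pow]
  have heq : orderOf (g * z ^ c) = orderOf g :=
    le_antisymm (Nat.le_of_dvd (orderOf_pos _) hdvd) (hg _ hw)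
  have hlcm : orderOf (g * z ^ c) ∣ Nat.lcm m s := by
    refine orderOf_dvd_of_pow_eq_one ?_
    have h1 : (g * z) ^ Nat.lcm m s = 1 :=
      orderOf_dvd_iff_pow_eq_one.1 (Nat.dvd_lcm_left _ _)
    obtain ⟨t, ht⟩ := Nat.dvd_lcm_right m s
    have h2 : (z ^ c) ^ Nat.lcm m s = z ^ Nat.lcm m s := by
      rw [ht, pow_mul, hws, ← pow_mul]
    rwa [(comm _ hw).mul_pow, h2, ← (comm z hz).mul_pow]
  exact not_dvd_lcm s (right_ne_zero_of_mul (hks ▸ hz0)) (fun h => hps ((dvd_pow_self p hk0).trans h))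
    (hkn.trans (heq ▸ hlcm))

/-- Every coset of a central subgroup has a representative `g` such that multiplication by `g`
enlarges the orders of the elements of the subgroup, in the sense of divisibility. -/
theorem exists_coset_rep_orderOf_dvd {G : Type*} [Group G] [Finite G] {H : Subgroup G}
    (hH : H ≤ Subgroup.center G) (q : G ⧸ H) :
    ∃ g : G, (g : G ⧸ H) = q ∧ ∀ z ∈ H, orderOf z ∣ orderOf (g * z) := by
  obtain ⟨g, hgq, hg⟩ := Set.exists_min_image {g : G | (g : G ⧸ H) = q} orderOf
    (Set.toFinite _) (QuotientGroup.mk_surjective q)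
  refine ⟨g, hgq, fun z hz => orderOf_dvd_orderOf_mul_of_minimal hH (fun w hw => ?_) hz⟩
  exact hg _ ((QuotientGroup.mk_mul_of_mem g hw).trans hgq)

/-- The ratio `α` does not decrease on passing to a central subgroup. -/
theorem alpha_le_alpha_of_le_center {G : Type*} [Group G] [Finite G] {H : Subgroup G}
    (hH : H ≤ Subgroup.center G) : alpha G ≤ alpha H := by
  classical
  have := Fintype.ofFinite G
  choose r hr hdvd using exists_coset_rep_orderOf_dvd hH
  have hbij : Function.Bijective fun x : (G ⧸ H) × H => r x.1 * x.2 := by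
    constructor
    · rintro ⟨q, z⟩ ⟨q', z'⟩ h
      have hq : q = q' := by
        have := congrArg (QuotientGroup.mk : G → G ⧸ H) h
        simpa [QuotientGroup.mk_mul_of_mem, hr] using this
      subst hq
      simpa using h
    · intro x
      refine ⟨⟨x, (r x)⁻¹ * x, QuotientGroup.eq.1 (hr x)⟩, by simp⟩
  have hsum : (Nat.card {K : Subgroup G // IsCyclic K} : ℚ) ≤
      Nat.card (G ⧸ H) * Nat.card {K : Subgroup H // IsCyclic K} := by
    rw [card_isCyclic_subgroup_eq_sum, card_isCyclic_subgroup_eq_sum,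
      ← hbij.sum_comp fun x => (1 : ℚ) / (Nat.totient (orderOf x) : ℚ), Fintype.sum_prod_type,
      Nat.card_eq_fintype_card, ← nsmul_eq_mul, ← Finset.card_univ]
    refine Finset.sum_le_card_nsmul _ _ _ fun q _ => Finset.sum_le_sum fun z _ => ?_
    refine one_div_le_one_div_of_le ?_ ?_
    · exact_mod_cast Nat.totient_pos.2 (orderOf_pos z)
    · rw [← Subgroup.orderOf_coe z]
      exact_mod_cast Nat.le_of_dvd (Nat.totient_pos.2 (orderOf_pos _))
        (Nat.totient_dvd_of_dvd (hdvd q z z.2))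
  have hG : (0 : ℚ) < Nat.card G := by exact_mod_cast Nat.card_pos
  have hHpos : (0 : ℚ) < Nat.card H := by exact_mod_cast Nat.card_pos
  have hcard : (Nat.card G : ℚ) = Nat.card (G ⧸ H) * Nat.card H := by
    exact_mod_cast H.card_eq_card_quotient_mul_card_subgroup
  rw [alpha, alpha, div_le_div_iff₀ hG hHpos, hcard]
  calc _ ≤ _ := mul_le_mul_of_nonneg_right hsum hHpos.le
    _ = _ := by ring

/-- For every finite group `G`, one has `α(G) ≤ α(Z(G))`. -/
theorem alpha_le_alpha_center (G : Type*) [Group G] [Finite G] :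
    alpha G ≤ alpha (Subgroup.center G) :=
  alpha_le_alpha_of_le_center le_rfl
end

section
/- Let G be a finite group. Then α(G) = α(Z(G)) if and only if G is isomorphic to a direct product G₁ × G₂, where G₁ is a 2-group such that every coset of Z(G₁) in G₁ contains an element of order at most 2 (i.e. G₁ = Ω₁(G₁)Z(G₁)), and G₂ is an abelian group of odd order. -/
theorem Nat.Prime.pow_dvd_lcm_iff {p k a b : ℕ} (hp : p.Prime) (ha : a ≠ 0) (hb : b ≠ 0) :
    p ^ k ∣ a.lcm b ↔ p ^ k ∣ a ∨ p ^ k ∣ b := by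
  rw [hp.pow_dvd_iff_le_factorization (Nat.lcm_ne_zero ha hb),
    hp.pow_dvd_iff_le_factorization ha, hp.pow_dvd_iff_le_factorization hb,
    Nat.factorization_lcm ha hb]
  simp

/-- A power of `x` is the `p`-part of `x`. -/
theorem exists_pow_orderOf_dvd_prime_pow {G : Type*} [Group G] [Finite G] (x : G) {p : ℕ}
    (hp : p.Prime) : ∃ u b q : ℕ, ¬ p ∣ q ∧ orderOf x = p ^ b * q ∧
      orderOf (x ^ u) ∣ p ^ b ∧ orderOf ((x ^ u)⁻¹ * x) ∣ q := by
  obtain ⟨b, q, hq, hx⟩ :=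
    Nat.exists_eq_pow_mul_and_not_dvd (orderOf_pos x).ne' p hp.ne_one
  have hcop : (p ^ b).Coprime q := (hp.coprime_iff_not_dvd.2 hq).pow_left b
  obtain ⟨u, hu₁, hu₂⟩ := Nat.chineseRemainder hcop 1 0
  refine ⟨u, b, q, hq, hx, ?_, ?_⟩
  · rw [orderOf_dvd_iff_pow_eq_one, ← pow_mul, ← orderOf_dvd_iff_pow_eq_one, hx, mul_comm]
    exact Nat.mul_dvd_mul_right ((Nat.modEq_zero_iff_dvd).1 hu₂) _
  · have hcomm : Commute (x ^ u)⁻¹ x := ((Commute.refl x).pow_left u).inv_left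
    rw [orderOf_dvd_iff_pow_eq_one, hcomm.mul_pow, inv_pow, inv_mul_eq_one, ← pow_mul,
      pow_eq_pow_iff_modEq, hx]
    simpa using hu₁.mul_right' q

/-- An element of minimal order in a coset of the center has translates of large order. -/
theorem orderOf_dvd_orderOf_mul_of_forall_le {G : Type*} [Group G] [Finite G] {x : G}
    (hx : ∀ z ∈ Subgroup.center G, orderOf x ≤ orderOf (x * z)) {z : G}
    (hz : z ∈ Subgroup.center G) : orderOf z ∣ orderOf (x * z) := by
  have hcomm (a : G) {c : G} (hc : c ∈ Subgroup.center G) : Commute a c :=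
    Subgroup.mem_center_iff.1 hc a
  rw [Nat.dvd_iff_prime_pow_dvd_dvd]
  intro p k hp hk
  by_contra hkm
  obtain ⟨u, b, q, hq, hzo, h₁, h₂⟩ := exists_pow_orderOf_dvd_prime_pow z hp
  have hpos (g : G) : orderOf g ≠ 0 := (orderOf_pos g).ne'
  have hq₀ : q ≠ 0 := by rintro rfl; simp at hq
  have hkb : k ≤ b := by
    rw [hzo] at hk
    exact (Nat.pow_dvd_pow_iff_le_right hp.one_lt).1
      (Nat.Coprime.dvd_of_dvd_mul_right ((hp.coprime_iff_not_dvd.2 hq).pow_left k) hk)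
  have hbm : ¬ p ^ b ∣ orderOf (x * z) := fun h => hkm ((pow_dvd_pow p hkb).trans h)
  have hb₀ : b ≠ 0 := by rintro rfl; simp at hbm
  have hbx : p ^ b ∣ orderOf x := by
    have h : orderOf z ∣ (orderOf x).lcm (orderOf (x * z)) := by
      have hc : Commute x⁻¹ (x * z) :=
        ((Commute.refl x).inv_left).mul_right (hcomm x⁻¹ hz)
      simpa using hc.orderOf_mul_dvd_lcm
    have h' := ((Dvd.intro q hzo.symm).trans h)
    rw [hp.pow_dvd_lcm_iff (hpos _) (hpos _)] at h'
    exact h'.resolve_right hbm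
  have hzu : z ^ u ∈ Subgroup.center G := pow_mem hz u
  have hw : ((z ^ u)⁻¹ * z) ∈ Subgroup.center G := mul_mem (inv_mem hzu) hz
  have hdvd : orderOf (x * z ^ u) ∣ orderOf x :=
    ((hcomm x hzu).orderOf_mul_dvd_lcm).trans (Nat.lcm_dvd dvd_rfl (h₁.trans hbx))
  have hnd : ¬ p ^ b ∣ orderOf (x * z ^ u) := by
    intro h
    have h3 : orderOf (x * z ^ u) ∣ (orderOf (x * z)).lcm q := by
      have := (hcomm (x * z) (inv_mem hw)).orderOf_mul_dvd_lcm
      rw [orderOf_inv] at this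
      have e : x * z * ((z ^ u)⁻¹ * z)⁻¹ = x * z ^ u := by group
      rw [e] at this
      exact this.trans (Nat.lcm_dvd (Nat.dvd_lcm_left _ _) (h₂.trans (Nat.dvd_lcm_right _ _)))
    rcases (hp.pow_dvd_lcm_iff (hpos _) hq₀).1 (h.trans h3) with h | h
    · exact hbm h
    · exact hq ((dvd_pow_self p hb₀).trans h)
  have heq : orderOf (x * z ^ u) = orderOf x :=
    le_antisymm (Nat.le_of_dvd (orderOf_pos x) hdvd) (hx _ hzu)
  exact hnd (heq ▸ hbx)

theorem exists_mem_center_orderOf_dvd {G : Type*} [Group G] [Finite G] (g : G) :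
    ∃ c ∈ Subgroup.center G, (∀ z ∈ Subgroup.center G, orderOf (g * c) ≤ orderOf (g * z)) ∧
      ∀ z ∈ Subgroup.center G, orderOf z ∣ orderOf (g * c * z) := by
  obtain ⟨c, hc⟩ := Finite.exists_min fun c : Subgroup.center G => orderOf (g * c)
  refine ⟨c, c.2, fun z hz => hc ⟨z, hz⟩, fun z hz => ?_⟩
  refine orderOf_dvd_orderOf_mul_of_forall_le (fun w hw => ?_) hz
  simpa [mul_assoc] using hc (c * ⟨w, hw⟩)

/-- The reciprocal of the number of generators of the cyclic subgroup generated by `g`. -/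
noncomputable def generatorWeight {G : Type*} [Group G] (g : G) : ℚ :=
  ((orderOf g).totient : ℚ)⁻¹

open scoped Classical in
theorem card_filter_zpowers_eq {G : Type*} [Group G] [Fintype G] (g : G) :
    (Finset.univ.filter fun h : G => Subgroup.zpowers h = Subgroup.zpowers g).card =
      (orderOf g).totient := by
  have hd : orderOf g ∣ Fintype.card (Subgroup.zpowers g) := by
    rw [← Nat.card_eq_fintype_card, Nat.card_zpowers]
  rw [← IsCyclic.card_orderOf_eq_totient hd]
  symm
  refine Finset.card_bij (fun a _ => (a : G)) ?_ (fun _ _ _ _ h => Subtype.ext h) ?_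
  · intro a ha
    rw [Finset.mem_filter] at ha ⊢
    refine ⟨Finset.mem_univ _, Subgroup.eq_of_le_of_card_ge (Subgroup.zpowers_le.2 a.2) ?_⟩
    rw [Nat.card_zpowers, Nat.card_zpowers, Subgroup.orderOf_coe, ha.2]
  · intro h hh
    rw [Finset.mem_filter] at hh
    refine ⟨⟨h, hh.2 ▸ Subgroup.mem_zpowers h⟩, ?_, rfl⟩
    rw [Finset.mem_filter]
    refine ⟨Finset.mem_univ _, ?_⟩
    rw [← Subgroup.orderOf_coe, ← Nat.card_zpowers, hh.2, Nat.card_zpowers]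

theorem card_isCyclic_eq_sum_generatorWeight (G : Type*) [Group G] [Fintype G] :
    (Nat.card {H : Subgroup G // IsCyclic H} : ℚ) = ∑ g : G, generatorWeight g := by
  classical
  let f : G → {H : Subgroup G // IsCyclic H} := fun g => ⟨Subgroup.zpowers g, inferInstance⟩
  rw [← Finset.sum_fiberwise Finset.univ f, Nat.card_eq_fintype_card, Fintype.card,
    Finset.card_eq_sum_ones, Nat.cast_sum]
  refine Finset.sum_congr rfl fun H _ => ?_
  obtain ⟨H, hH⟩ := H
  obtain ⟨g, rfl⟩ := (Subgroup.isCyclic_iff_exists_zpowers_eq_top H).1 hH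
  have hfil : (Finset.univ.filter fun h => f h = ⟨Subgroup.zpowers g, hH⟩) =
      Finset.univ.filter fun h : G => Subgroup.zpowers h = Subgroup.zpowers g := by
    ext h; simp [f]
  have hne : ((orderOf g).totient : ℚ) ≠ 0 := by
    exact_mod_cast (Nat.totient_pos.2 (orderOf_pos g)).ne'
  rw [hfil, Finset.sum_congr rfl (g := fun _ => ((orderOf g).totient : ℚ)⁻¹),
    Finset.sum_const, card_filter_zpowers_eq, nsmul_eq_mul, mul_inv_cancel₀ hne, Nat.cast_one]
  intro h hh
  rw [generatorWeight, ← Nat.card_zpowers, (Finset.mem_filter.1 hh).2, Nat.card_zpowers]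

theorem alpha_eq_sum_generatorWeight_div (G : Type*) [Group G] [Fintype G] :
    alpha G = (∑ g : G, generatorWeight g) / Nat.card G := by
  rw [alpha, card_isCyclic_eq_sum_generatorWeight]

open scoped Classical in
/-- The total weight of a coset of the center. -/
noncomputable def centerCosetWeight {G : Type*} [Group G] [Fintype G] (g : G) : ℚ :=
  ∑ z : Subgroup.center G, generatorWeight (g * z)

theorem centerCosetWeight_mul {G : Type*} [Group G] [Fintype G] (g : G) {c : G}
    (hc : c ∈ Subgroup.center G) : centerCosetWeight (g * c) = centerCosetWeight g := by
  classical
  refine Fintype.sum_equiv (Equiv.mulLeft ⟨c, hc⟩) _ _ fun z => ?_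
  simp [mul_assoc]

theorem sum_centerCosetWeight (G : Type*) [Group G] [Fintype G] :
    ∑ g : G, centerCosetWeight g = Nat.card (Subgroup.center G) * ∑ g : G, generatorWeight g := by
  classical
  simp only [centerCosetWeight]
  rw [Finset.sum_comm, Finset.sum_congr rfl (g := fun _ => ∑ g : G, generatorWeight g)]
  · simp [Nat.card_eq_fintype_card]
  · exact fun z _ => Fintype.sum_equiv (Equiv.mulRight (z : G)) _ _ fun g => rfl

theorem alpha_center_eq_centerCosetWeight_one_div (G : Type*) [Group G] [Fintype G] :
    alpha (Subgroup.center G) =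
      centerCosetWeight (1 : G) / Nat.card (Subgroup.center G) := by
  classical
  rw [alpha_eq_sum_generatorWeight_div]
  simp only [centerCosetWeight, generatorWeight, one_mul, Subgroup.orderOf_coe]

theorem inv_totient_le_of_dvd {m n : ℕ} (hm : m ≠ 0) (hn : n ≠ 0) (h : m ∣ n) :
    (n.totient : ℚ)⁻¹ ≤ (m.totient : ℚ)⁻¹ := by
  have hm' := Nat.totient_pos.2 (Nat.pos_of_ne_zero hm)
  have hn' := Nat.totient_pos.2 (Nat.pos_of_ne_zero hn)
  exact inv_anti₀ (by exact_mod_cast hm')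
    (by exact_mod_cast Nat.le_of_dvd hn' (Nat.totient_dvd_of_dvd h))

theorem generatorWeight_mul_le {G : Type*} [Group G] [Finite G] {x z : G}
    (h : orderOf z ∣ orderOf (x * z)) : generatorWeight (x * z) ≤ generatorWeight z :=
  inv_totient_le_of_dvd (orderOf_pos _).ne' (orderOf_pos _).ne' h

theorem centerCosetWeight_le {G : Type*} [Group G] [Fintype G] (g : G) :
    centerCosetWeight g ≤ centerCosetWeight (1 : G) := by
  obtain ⟨c, hc, -, hdvd⟩ := exists_mem_center_orderOf_dvd g
  rw [← centerCosetWeight_mul g hc]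
  refine Finset.sum_le_sum fun z _ => ?_
  rw [one_mul]
  exact generatorWeight_mul_le (hdvd z z.2)

theorem Nat.totient_eq_of_dvd_of_dvd_two_lcm {m n : ℕ} (hmn : m ∣ n) (hn : n ∣ Nat.lcm 2 m) :
    n.totient = m.totient := by
  rcases Nat.even_or_odd m with hm | hm
  · rw [Nat.dvd_antisymm (hn.trans (Nat.lcm_dvd hm.two_dvd dvd_rfl)) hmn]
  · refine Nat.dvd_antisymm ?_ (Nat.totient_dvd_of_dvd hmn)
    rw [← Nat.totient_two_mul_of_odd hm]
    exact Nat.totient_dvd_of_dvd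
      (hn.trans (Nat.lcm_dvd (Nat.dvd_mul_right _ _) (Nat.dvd_mul_left _ _)))

theorem sq_eq_one_iff_orderOf_le_two {G : Type*} [Group G] [Finite G] (g : G) :
    g ^ 2 = 1 ↔ orderOf g ≤ 2 := by
  rw [← orderOf_dvd_iff_pow_eq_one, Nat.dvd_prime Nat.prime_two]
  have := orderOf_pos g
  omega

open scoped Classical in
theorem centerCosetWeight_eq_iff {G : Type*} [Group G] [Fintype G] (g : G) :
    centerCosetWeight g = centerCosetWeight (1 : G) ↔
      ∃ z ∈ Subgroup.center G, orderOf (g * z) ≤ 2 := by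
  obtain ⟨c, hc, hmin, hdvd⟩ := exists_mem_center_orderOf_dvd g
  rw [← centerCosetWeight_mul g hc, centerCosetWeight, centerCosetWeight,
    Finset.sum_eq_sum_iff_of_le]
  swap
  · intro z _
    rw [one_mul]
    exact generatorWeight_mul_le (hdvd z z.2)
  constructor
  · intro h
    refine ⟨c, hc, ?_⟩
    have h1 : (orderOf (g * c)).totient = 1 := by
      have := h 1 (Finset.mem_univ _)
      simpa [generatorWeight] using this
    rcases Nat.totient_eq_one_iff.1 h1 with h | h <;> omega
  · rintro ⟨w, hw, hwo⟩ z -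
    have h2 : orderOf (g * c) ∣ 2 := orderOf_dvd_of_pow_eq_one
      ((sq_eq_one_iff_orderOf_le_two _).2 ((hmin w hw).trans hwo))
    have hcomm : Commute (g * c) (z : G) := Subgroup.mem_center_iff.1 z.2 _
    rw [one_mul, generatorWeight, generatorWeight,
      Nat.totient_eq_of_dvd_of_dvd_two_lcm (hdvd z z.2) (hcomm.orderOf_mul_dvd_lcm.trans
        (Nat.lcm_dvd (h2.trans (Nat.dvd_lcm_left _ _)) (Nat.dvd_lcm_right _ _)))]

theorem alpha_eq_alpha_center_iff_forall_exists (G : Type*) [Group G] [Finite G] :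
    alpha G = alpha (Subgroup.center G) ↔
      ∀ g : G, ∃ z ∈ Subgroup.center G, orderOf (g * z) ≤ 2 := by
  have := Fintype.ofFinite G
  have hG : (Nat.card G : ℚ) ≠ 0 := by exact_mod_cast Nat.card_pos.ne'
  have hZ : (Nat.card (Subgroup.center G) : ℚ) ≠ 0 := by exact_mod_cast Nat.card_pos.ne'
  have key := Finset.sum_eq_sum_iff_of_le (s := Finset.univ)
    fun (g : G) _ => centerCosetWeight_le g
  simp only [centerCosetWeight_eq_iff, Finset.mem_univ, true_imp_iff] at key
  rw [← key, sum_centerCosetWeight, alpha_eq_sum_generatorWeight_div,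
    alpha_center_eq_centerCosetWeight_one_div, div_eq_div_iff hG hZ, Finset.sum_const,
    Finset.card_univ, ← Nat.card_eq_fintype_card, nsmul_eq_mul, mul_comm,
    mul_comm (centerCosetWeight 1)]

/-- A central subgroup with a complement is a direct factor. -/
theorem Subgroup.IsComplement'.nonempty_mulEquiv_prod {G : Type*} [Group G] {N K : Subgroup G}
    (h : N.IsComplement' K) (hN : N ≤ Subgroup.center G) : Nonempty (G ≃* K × N) := by
  let f : K × N →* G := MonoidHom.noncommCoprod K.subtype N.subtype
    fun k n => Subgroup.mem_center_iff.1 (hN n.2) k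
  exact ⟨(MulEquiv.ofBijective f h.symm).symm⟩

/-- The elements of the center annihilated by `m`. -/
def centerTorsion (G : Type*) [Group G] (m : ℕ) : Subgroup G where
  carrier := {z | z ∈ Subgroup.center G ∧ z ^ m = 1}
  one_mem' := ⟨one_mem _, one_pow m⟩
  mul_mem' := by
    rintro a b ⟨ha, ha'⟩ ⟨hb, hb'⟩
    have hab : Commute a b := Subgroup.mem_center_iff.1 hb a
    exact ⟨mul_mem ha hb, by rw [hab.mul_pow, ha', hb', one_mul]⟩
  inv_mem' := by
    rintro a ⟨ha, ha'⟩
    exact ⟨inv_mem ha, by rw [inv_pow, ha', inv_one]⟩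

theorem centerTorsion_le_center (G : Type*) [Group G] (m : ℕ) :
    centerTorsion G m ≤ Subgroup.center G := fun _ h => h.1

instance (G : Type*) [Group G] (m : ℕ) : (centerTorsion G m).Normal where
  conj_mem n hn g := by
    rwa [Subgroup.mem_center_iff.1 hn.1 g, mul_inv_cancel_right]

theorem odd_card_centerTorsion (G : Type*) [Group G] [Finite G] {m : ℕ} (hm : Odd m) :
    Odd (Nat.card (centerTorsion G m)) := by
  rw [← Nat.not_even_iff_odd, even_iff_two_dvd]
  intro h
  obtain ⟨x, hx⟩ := exists_prime_orderOf_dvd_card' 2 h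
  have hxm : orderOf x ∣ m := orderOf_dvd_of_pow_eq_one (Subtype.ext x.2.2)
  rw [hx] at hxm
  exact (Nat.not_even_iff_odd.2 hm) (even_iff_two_dvd.2 hxm)

theorem sq_mem_center_of_sq_mul_eq_one {G : Type*} [Group G] {g z : G}
    (hz : z ∈ Subgroup.center G) (h : (g * z) ^ 2 = 1) : g ^ 2 ∈ Subgroup.center G := by
  have hgz : Commute g z := Subgroup.mem_center_iff.1 hz g
  rw [hgz.mul_pow] at h
  rw [eq_inv_of_mul_eq_one_left h]
  exact inv_mem (pow_mem hz 2)

theorem exists_pow_two_pow_mem_centerTorsion {G : Type*} [Group G] {k m : ℕ}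
    (hcard : Nat.card G = 2 ^ k * m) {g : G} (hg : g ^ 2 ∈ Subgroup.center G) :
    g ^ 2 ^ (k + 1) ∈ centerTorsion G m := by
  constructor
  · rw [pow_succ', pow_mul]
    exact pow_mem hg _
  · rw [← pow_mul, pow_succ, mul_right_comm, ← hcard, pow_mul, pow_card_eq_one', one_pow]

/-- If every coset of the center contains an element of order at most two, then the odd part of
the center is a direct factor whose complement is a `2`-group with the same property. -/
theorem exists_two_group_prod_odd_center {G : Type*} [Group G] [Finite G]
    (h : ∀ g : G, ∃ z ∈ Subgroup.center G, orderOf (g * z) ≤ 2) :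
    ∃ K N : Subgroup G, Nonempty (G ≃* K × N) ∧ IsPGroup 2 K ∧
      (∀ g : K, ∃ z ∈ Subgroup.center K, orderOf (g * z) ≤ 2) ∧
      N ≤ Subgroup.center G ∧ Odd (Nat.card N) := by
  simp only [← sq_eq_one_iff_orderOf_le_two] at h ⊢
  obtain ⟨k, m, hm, hcard⟩ := Nat.exists_eq_two_pow_mul_odd (Nat.card_pos (α := G)).ne'
  have hpow (g : G) : g ^ 2 ^ (k + 1) ∈ centerTorsion G m := by
    obtain ⟨z, hz, hgz⟩ := h g
    exact exists_pow_two_pow_mem_centerTorsion hcard (sq_mem_center_of_sq_mul_eq_one hz hgz)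
  have hodd := odd_card_centerTorsion G hm
  have hquot : IsPGroup 2 (G ⧸ centerTorsion G m) := fun q =>
    q.induction_on fun g => ⟨k + 1, (QuotientGroup.eq_one_iff _).2 (hpow g)⟩
  have hcop : (Nat.card (centerTorsion G m)).Coprime (centerTorsion G m).index := by
    obtain ⟨n, hn⟩ := IsPGroup.iff_card.1 hquot
    rw [Subgroup.index, hn]
    exact (Nat.coprime_two_right.2 hodd).pow_right n
  obtain ⟨K, hK⟩ := Subgroup.exists_right_complement'_of_coprime hcop
  have hinter {x : G} (hx : x ∈ centerTorsion G m) (hx' : x ∈ K) : x = 1 :=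
    Subgroup.disjoint_def.1 hK.disjoint hx hx'
  refine ⟨K, centerTorsion G m, hK.nonempty_mulEquiv_prod (centerTorsion_le_center G m),
    fun g => ⟨k + 1, Subtype.ext (hinter (hpow g) (pow_mem g.2 _))⟩, fun g => ?_,
    centerTorsion_le_center G m, hodd⟩
  obtain ⟨z, hz, hgz⟩ := h g
  obtain ⟨⟨n, c⟩, rfl⟩ := hK.2 z
  have hn : (n : G) ∈ Subgroup.center G := n.2.1
  have hc : (c : G) ∈ Subgroup.center G := (Subgroup.mul_mem_cancel_left _ hn).1 hz
  refine ⟨c, Subgroup.mem_center_iff.2 fun y => Subtype.ext (Subgroup.mem_center_iff.1 hc y),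
    Subtype.ext (hinter ?_ (pow_mem (g * c).2 2))⟩
  have hcomm : Commute (n : G) ((g * c : K) : G) := (Subgroup.mem_center_iff.1 hn _).symm
  have hmul : (n : G) ^ 2 * ((g * c : K) : G) ^ 2 = 1 := by
    rw [← hcomm.mul_pow, ← hgz, Subgroup.coe_mul, ← mul_assoc, ← mul_assoc,
      Subgroup.mem_center_iff.1 hn g]
  rw [Subgroup.coe_pow, eq_inv_of_mul_eq_one_right hmul]
  exact inv_mem (pow_mem n.2 2)

/-- `α(G) = α(Z(G))` iff `G ≅ G₁ × G₂` where `G₁` is a 2-group with every coset of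
`Z(G₁)` containing an element of order at most 2, and `G₂` is abelian of odd order. -/
theorem alpha_eq_alpha_center_iff (G : Type*) [Group G] [Finite G] :
    alpha G = alpha (Subgroup.center G) ↔
      ∃ (G₁ : Type) (_ : Group G₁) (G₂ : Type) (_ : Group G₂),
        Finite G₁ ∧ IsPGroup 2 G₁ ∧
        (∀ g : G₁, ∃ z ∈ Subgroup.center G₁, orderOf (g * z) ≤ 2) ∧
        Finite G₂ ∧ (∀ a b : G₂, a * b = b * a) ∧ Odd (Nat.card G₂) ∧
        Nonempty (G ≃* G₁ × G₂) := by
  rw [alpha_eq_alpha_center_iff_forall_exists]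
  constructor
  · intro h
    obtain ⟨K, N, ⟨e⟩, hK, hcos, hN, hodd⟩ := exists_two_group_prod_odd_center h
    let eK := Shrink.mulEquiv.{0} (α := K)
    let eN := Shrink.mulEquiv.{0} (α := N)
    refine ⟨Shrink.{0} K, inferInstance, Shrink.{0} N, inferInstance,
      Finite.of_equiv K eK.symm.toEquiv, hK.of_equiv eK.symm, ?_,
      Finite.of_equiv N eN.symm.toEquiv, fun a b => ?_, ?_,
      ⟨e.trans (eK.symm.prodCongr eN.symm)⟩⟩
    · intro g
      obtain ⟨z, hz, hzo⟩ := hcos (eK g)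
      refine ⟨eK.symm z, ?_, ?_⟩
      · rw [Subgroup.mem_center_iff] at hz ⊢
        intro y
        apply eK.injective
        simpa using hz (eK y)
      · rw [← MulEquiv.orderOf_eq eK]
        simpa using hzo
    · apply eN.injective
      rw [map_mul, map_mul]
      exact Subtype.ext (Subgroup.mem_center_iff.1 (hN (eN b).2) _)
    · rwa [Nat.card_congr eN.toEquiv]
  · rintro ⟨G₁, _, G₂, _, _, -, hcos, _, hcomm, -, ⟨e⟩⟩ g
    obtain ⟨z, hz, hzo⟩ := hcos (e g).1
    refine ⟨e.symm (z, (e g).2⁻¹), ?_, ?_⟩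
    · rw [Subgroup.mem_center_iff] at hz ⊢
      intro y
      apply e.injective
      rw [map_mul, map_mul, e.apply_symm_apply]
      exact Prod.ext (hz _) (hcomm _ _)
    · rw [← sq_eq_one_iff_orderOf_le_two] at hzo ⊢
      apply e.injective
      rw [map_pow, map_mul, e.apply_symm_apply, map_one]
      exact Prod.ext hzo (by simp)
end

section
/- Let G be a finite group with α(G) = α(Z(G)). Then G is isomorphic to a direct product G₁ × G₂, where G₁ is a 2-group in which every coset of Z(G₁) contains an element of order at most 2, and G₂ is an abelian group of odd order. -/
open Subgroup

section CyclicSubgroupCount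

variable {G : Type*} [Group G] [Finite G]

/-- The generators of a finite cyclic group `⟨g⟩` number `φ(o(g))`. -/
theorem card_zpowers_eq_zpowers (g : G) :
    Nat.card {x : G // zpowers x = zpowers g} = (orderOf g).totient := by
  classical
  have := Fintype.ofFinite (zpowers g)
  have e : {x : G // zpowers x = zpowers g} ≃
      {y : zpowers g // orderOf y = Fintype.card (zpowers g)} :=
    { toFun := fun x => ⟨⟨x, x.2.le (mem_zpowers x.1)⟩, by
        rw [orderOf_mk, ← Nat.card_zpowers, x.2, Nat.card_eq_fintype_card]⟩
      invFun := fun y => ⟨y.1, Subgroup.eq_of_le_of_card_ge (zpowers_le.2 y.1.2) (by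
        rw [Nat.card_zpowers (y.1 : G), orderOf_coe, y.2, Nat.card_eq_fintype_card])⟩
      left_inv := fun _ => rfl
      right_inv := fun _ => rfl }
  rw [Nat.card_congr e, Nat.card_eq_fintype_card, Fintype.card_subtype,
    IsCyclic.card_orderOf_eq_totient dvd_rfl, ← Nat.card_eq_fintype_card, Nat.card_zpowers]

theorem card_isCyclic_eq_sum [Fintype G] :
    (Nat.card {H : Subgroup G // IsCyclic H} : ℚ) = ∑ x : G, ((orderOf x).totient : ℚ)⁻¹ := by
  classical
  have := Fintype.ofFinite {H : Subgroup G // IsCyclic H}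
  let f : G → {H : Subgroup G // IsCyclic H} := fun x => ⟨zpowers x, inferInstance⟩
  rw [← Fintype.sum_fiberwise f, Nat.card_eq_fintype_card, Fintype.card_eq_sum_ones,
    Nat.cast_sum]
  refine Finset.sum_congr rfl fun ⟨H, hH⟩ _ => ?_
  obtain ⟨g, rfl⟩ := H.isCyclic_iff_exists_zpowers_eq_top.1 hH
  have hfib (x : {x : G // f x = ⟨zpowers g, hH⟩}) :
      ((orderOf x.1).totient : ℚ)⁻¹ = ((orderOf g).totient : ℚ)⁻¹ := by
    have hx : zpowers x.1 = zpowers g := congrArg Subtype.val x.2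
    rw [← Nat.card_zpowers x.1, hx, Nat.card_zpowers]
  have hcard : Fintype.card {x : G // f x = ⟨zpowers g, hH⟩} = (orderOf g).totient := by
    rw [← card_zpowers_eq_zpowers, ← Nat.card_eq_fintype_card]
    simp [f]
  have hpos : ((orderOf g).totient : ℚ) ≠ 0 :=
    Nat.cast_ne_zero.2 (Nat.totient_pos.2 (orderOf_pos g)).ne'
  rw [Finset.sum_congr rfl fun x _ => hfib x, Finset.sum_const, nsmul_eq_mul, Finset.card_univ,
    hcard, mul_inv_cancel₀ hpos, Nat.cast_one]

theorem alpha_mul_card [Fintype G] :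
    alpha G * Nat.card G = ∑ x : G, ((orderOf x).totient : ℚ)⁻¹ := by
  rw [alpha, div_mul_cancel₀ _ (by exact_mod_cast Nat.card_pos.ne'), card_isCyclic_eq_sum]

end CyclicSubgroupCount

/-- If `m ∤ n`, the `p`-parts of `m` and `n` can be compared at a suitable prime `p`. -/
theorem Nat.exists_pow_mul_of_not_dvd {m n : ℕ} (hm : m ≠ 0) (hn : n ≠ 0) (h : ¬ m ∣ n) :
    ∃ p a b m' n', p.Prime ∧ m = p ^ b * m' ∧ n = p ^ a * n' ∧ a < b ∧ (p ^ b).Coprime n' := by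
  rw [← Nat.factorization_le_iff_dvd hm hn, Finsupp.le_def] at h
  push Not at h
  obtain ⟨p, hp⟩ := h
  have hpp : p.Prime := by
    by_contra hc
    simp [Nat.factorization_eq_zero_of_not_prime _ hc] at hp
  exact ⟨p, _, _, _, _, hpp, (Nat.ordProj_mul_ordCompl_eq_self m p).symm,
    (Nat.ordProj_mul_ordCompl_eq_self n p).symm, hp, (Nat.coprime_ordCompl hpp hn).pow_left _⟩

section CentralCosets

variable {G : Type*} [Group G] [Finite G]

/-- If the order of `g` does not divide the order of `g * z`, with `z` commuting with `g`, then
some `g * z ^ k` has order smaller than `g`. -/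
theorem exists_orderOf_mul_zpow_lt {g z : G} (hgz : Commute g z)
    (h : ¬ orderOf g ∣ orderOf (g * z)) : ∃ k : ℤ, orderOf (g * z ^ k) < orderOf g := by
  obtain ⟨p, a, b, m, n, hp, hm, hn, hab, hcop⟩ :=
    Nat.exists_pow_mul_of_not_dvd (orderOf_pos g).ne' (orderOf_pos (g * z)).ne' h
  obtain ⟨u, v, huv⟩ := Nat.isCoprime_iff_coprime.2 hcop
  have hm0 : 0 < m := Nat.pos_of_ne_zero fun h0 => (orderOf_pos g).ne' (by simp [hm, h0])
  have hdecomp : g * z ^ (v * n) = g ^ (u * ↑(p ^ b)) * (g * z) ^ (v * n) := by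
    rw [hgz.mul_zpow, ← mul_assoc, ← zpow_add, huv, zpow_one]
  have hpow : (g * z ^ (v * n)) ^ (p ^ a * m) = 1 := by
    have hc : Commute (g ^ (u * ↑(p ^ b))) ((g * z) ^ (v * n)) :=
      (((Commute.refl g).mul_right hgz).zpow_left _).zpow_right _
    have h₁ : (g ^ (u * ↑(p ^ b))) ^ (p ^ a * m) = 1 := by
      rw [← zpow_natCast, ← zpow_mul]
      refine orderOf_dvd_iff_zpow_eq_one.1 ⟨u * p ^ a, ?_⟩
      rw [hm]
      push_cast
      ring
    have h₂ : ((g * z) ^ (v * n)) ^ (p ^ a * m) = 1 := by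
      rw [← zpow_natCast, ← zpow_mul]
      refine orderOf_dvd_iff_zpow_eq_one.1 ⟨v * m, ?_⟩
      rw [hn]
      push_cast
      ring
    rw [hdecomp, hc.mul_pow, h₁, h₂, one_mul]
  refine ⟨v * n, ?_⟩
  calc orderOf (g * z ^ (v * n)) ≤ p ^ a * m :=
        orderOf_le_of_pow_eq_one (Nat.mul_pos (pow_pos hp.pos _) hm0) hpow
    _ < p ^ b * m := Nat.mul_lt_mul_of_pos_right (Nat.pow_lt_pow_right hp.one_lt hab) hm0
    _ = orderOf g := hm.symm

/-- Every coset of the center has a representative `g` such that `o(z) ∣ o(gz)` for all central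
`z`. -/
theorem exists_center_orderOf_dvd (x : G) :
    ∃ w : center G, ∀ z : center G, orderOf (z : G) ∣ orderOf (x * w * z) := by
  obtain ⟨w, hw⟩ := Finite.exists_min fun w : center G => orderOf (x * w)
  refine ⟨w, fun z => ?_⟩
  have hcomm : Commute (x * w) (z : G) := (mem_center_iff.1 z.2 (x * w))
  have hdvd : orderOf (x * w) ∣ orderOf (x * w * z) := by
    by_contra hnd
    obtain ⟨k, hk⟩ := exists_orderOf_mul_zpow_lt hcomm hnd
    have := hw (w * z ^ k)
    simp only [coe_mul, SubgroupClass.coe_zpow, ← mul_assoc] at this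
    omega
  have hc : Commute (x * w)⁻¹ (x * w * z) :=
    ((Commute.refl (x * w)).mul_right hcomm).inv_left
  have hlcm := hc.orderOf_mul_dvd_lcm
  rw [inv_mul_cancel_left, orderOf_inv] at hlcm
  exact hlcm.trans (Nat.lcm_dvd hdvd dvd_rfl)

/-- If `α(G) = α(Z(G))`, every coset of the center contains an element of order at most `2`. -/
theorem exists_center_sq_eq_one (h : alpha G = alpha (center G)) (x : G) :
    ∃ w ∈ center G, (x * w) ^ 2 = 1 := by
  classical
  have := Fintype.ofFinite G
  let f : G → ℚ := fun x => ((orderOf x).totient : ℚ)⁻¹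
  let F : G → ℚ := fun x => ∑ z : center G, f (x * z)
  have hshift (x : G) (w : center G) : F (x * w) = F x := by
    simpa [F, mul_assoc] using Equiv.sum_comp (Equiv.mulLeft w) fun z : center G => f (x * z)
  have hf {a b : G} (hab : orderOf a ∣ orderOf b) : f b ≤ f a :=
    inv_anti₀ (by exact_mod_cast Nat.totient_pos.2 (orderOf_pos a))
      (Nat.cast_le.2 (Nat.le_of_dvd (Nat.totient_pos.2 (orderOf_pos b))
        (Nat.totient_dvd_of_dvd hab)))
  have hle (x : G) : F x ≤ F 1 := by
    obtain ⟨w, hw⟩ := exists_center_orderOf_dvd x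
    rw [← hshift x w]
    exact Finset.sum_le_sum fun z _ => hf (by simpa using hw z)
  have hone : F 1 = alpha (center G) * Nat.card (center G) := by
    refine Eq.trans ?_ alpha_mul_card.symm
    simp only [F, f, one_mul, orderOf_coe]
  have htotal : ∑ x, F x = ∑ _x : G, F 1 := by
    have : ∑ x, F x = Nat.card (center G) * ∑ x, f x := by
      simp only [F]
      rw [Finset.sum_comm]
      have hright (z : center G) : ∑ x, f (x * z) = ∑ x, f x :=
        Equiv.sum_comp (Equiv.mulRight (z : G)) f
      rw [Finset.sum_congr rfl fun z _ => hright z,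
        Finset.sum_const, nsmul_eq_mul, Finset.card_univ, ← Nat.card_eq_fintype_card]
    rw [this, ← alpha_mul_card, h, hone, Finset.sum_const, nsmul_eq_mul, Finset.card_univ,
      ← Nat.card_eq_fintype_card]
    ring
  have heq (x : G) : F x = F 1 :=
    (Finset.sum_eq_sum_iff_of_le fun x _ => hle x).1 htotal x (Finset.mem_univ x)
  obtain ⟨w, hw⟩ := exists_center_orderOf_dvd x
  have hterm := (Finset.sum_eq_sum_iff_of_le fun z _ => hf (by simpa using hw z)).1
    ((hshift x w).trans (heq x)) 1 (Finset.mem_univ _)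
  have htot : (orderOf (x * w)).totient = 1 := by
    simpa [f] using hterm
  refine ⟨w, w.2, orderOf_dvd_iff_pow_eq_one.1 ?_⟩
  rcases Nat.totient_eq_one_iff.1 htot with h' | h' <;> simp [h']

end CentralCosets

section Decomposition

variable {G : Type*} [Group G]

theorem mem_center_of_odd_orderOf (h : ∀ x : G, ∃ w ∈ center G, (x * w) ^ 2 = 1) (x : G)
    (hx : Odd (orderOf x)) : x ∈ center G := by
  obtain ⟨w, hw, hsq⟩ := h x
  have hc : Commute x w := mem_center_iff.1 hw x
  rw [hc.mul_pow] at hsq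
  have hx2 : x ^ 2 ∈ center G := by
    rw [eq_inv_of_mul_eq_one_left hsq]
    exact inv_mem (pow_mem hw 2)
  obtain ⟨k, hk⟩ := hx
  have : x = (x ^ 2) ^ (k + 1) := by
    rw [← pow_mul, show 2 * (k + 1) = 2 * k + 1 + 1 by ring, ← hk, pow_succ, pow_orderOf_eq_one,
      one_mul]
  rw [this]
  exact pow_mem hx2 _

/-- A group with `G = H K`, `H ∩ K = 1` and `H` central is the direct product of `K` and `H`. -/
noncomputable def Subgroup.IsComplement'.mulEquivProd {H K : Subgroup G} (hHK : IsComplement' H K)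
    (hH : H ≤ center G) : K × H ≃* G :=
  MulEquiv.ofBijective
    (K.subtype.noncommCoprod H.subtype fun k y => mem_center_iff.1 (hH y.2) k)
    hHK.symm

variable [Finite G]

/-- The subgroup of elements of odd order, when all of these are central. -/
def oddOrderSubgroup (hodd : ∀ x : G, Odd (orderOf x) → x ∈ center G) : Subgroup G where
  carrier := {x | Odd (orderOf x)}
  one_mem' := by simp
  mul_mem' {a b} ha hb := by
    have hc : Commute a b := mem_center_iff.1 (hodd b hb) a
    exact Odd.of_dvd_nat (Odd.mul ha hb) hc.orderOf_mul_dvd_mul_orderOf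
  inv_mem' {a} ha := by simpa using ha

theorem odd_card_of_forall_odd_orderOf (h : ∀ x : G, Odd (orderOf x)) : Odd (Nat.card G) := by
  by_contra hc
  obtain ⟨x, hx⟩ := exists_prime_orderOf_dvd_card' 2 (Nat.not_odd_iff_even.1 hc).two_dvd
  exact absurd (h x) (by simp [hx])

theorem exists_two_pow_odd_orderOf (x : G) : ∃ n, Odd (orderOf (x ^ 2 ^ n)) := by
  obtain ⟨n, m, hm, hx⟩ := Nat.exists_eq_two_pow_mul_odd (orderOf_pos x).ne'
  exact ⟨n, Odd.of_dvd_nat hm (orderOf_dvd_of_pow_eq_one (by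
    rw [← pow_mul, ← hx, pow_orderOf_eq_one]))⟩

end Decomposition

/-- If `α(G) = α(Z(G))`, then `G ≅ G₁ × G₂` where `G₁` is a 2-group with every coset of
`Z(G₁)` containing an element of order at most 2, and `G₂` is abelian of odd order. -/
theorem of_alpha_eq_alpha_center (G : Type*) [Group G] [Finite G]
    (h : alpha G = alpha (Subgroup.center G)) :
    ∃ (G₁ : Type) (_ : Group G₁) (G₂ : Type) (_ : Group G₂),
      Finite G₁ ∧ IsPGroup 2 G₁ ∧
      (∀ g : G₁, ∃ z ∈ Subgroup.center G₁, orderOf (g * z) ≤ 2) ∧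
      Finite G₂ ∧ (∀ a b : G₂, a * b = b * a) ∧ Odd (Nat.card G₂) ∧
      Nonempty (G ≃* G₁ × G₂) := by
  have hsq := exists_center_sq_eq_one h
  have hodd := mem_center_of_odd_orderOf hsq
  let O := oddOrderSubgroup hodd
  have hOZ : O ≤ center G := hodd
  have hOn : O.Normal := ⟨fun y hy g => by
    rwa [mem_center_iff.1 (hOZ hy) g, mul_inv_cancel_right]⟩
  have hOodd : Odd (Nat.card O) :=
    odd_card_of_forall_odd_orderOf fun y => by
      rw [← orderOf_coe]
      exact y.2
  have hquot : IsPGroup 2 (G ⧸ O) := fun q => by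
    induction q using QuotientGroup.induction_on with
    | H x =>
      obtain ⟨n, hn⟩ := exists_two_pow_odd_orderOf x
      exact ⟨n, (QuotientGroup.eq_one_iff _).2 hn⟩
  have hcop : (Nat.card O).Coprime O.index := by
    obtain ⟨n, hn⟩ := IsPGroup.iff_card.1 hquot
    rw [index_eq_card, hn]
    exact (Nat.coprime_two_right.2 hOodd).pow_right n
  obtain ⟨K, hK⟩ := exists_right_complement'_of_coprime hcop
  have hKO {x : G} (hx : x ∈ K) (hx' : x ∈ O) : x = 1 := disjoint_def.1 hK.disjoint hx' hx
  have hKp : IsPGroup 2 K := fun k => by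
    obtain ⟨n, hn⟩ := exists_two_pow_odd_orderOf (k : G)
    exact ⟨n, Subtype.ext (hKO (pow_mem k.2 _) hn)⟩
  have hKc (g : K) : ∃ z ∈ center K, orderOf (g * z) ≤ 2 := by
    obtain ⟨w, hw, hgw⟩ := hsq g
    obtain ⟨⟨y, k⟩, rfl⟩ := hK.surjective w
    have hy := hOZ y.2
    have hk : (k : G) ∈ center G := by
      simpa using mul_mem (inv_mem hy) hw
    refine ⟨k, mem_center_iff.2 fun a => Subtype.ext (mem_center_iff.1 hk a), ?_⟩
    refine orderOf_le_of_pow_eq_one two_pos (Subtype.ext (hKO (pow_mem (g * k).2 2) ?_))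
    have hc : Commute ((g : G) * k) y := mem_center_iff.1 hy _
    have hgw' : ((g : G) * k) ^ 2 * (y : G) ^ 2 = 1 := by
      rw [← hc.mul_pow, ← hgw, mul_assoc, mem_center_iff.1 hy k]
    rw [SubgroupClass.coe_pow, coe_mul, eq_inv_of_mul_eq_one_left hgw']
    exact inv_mem (pow_mem y.2 2)
  let eK : Shrink.{0} K ≃* K := Shrink.mulEquiv
  let eO : Shrink.{0} O ≃* O := Shrink.mulEquiv
  refine ⟨Shrink.{0} K, inferInstance, Shrink.{0} O, inferInstance, .of_equiv K eK.symm.toEquiv,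
    hKp.of_equiv eK.symm, fun g => ?_, .of_equiv O eO.symm.toEquiv, fun a b => ?_, ?_,
    ⟨(hK.mulEquivProd hOZ).symm.trans (eK.symm.prodCongr eO.symm)⟩⟩
  · obtain ⟨z, hz, hle⟩ := hKc (eK g)
    refine ⟨eK.symm z, mem_center_iff.2 fun a => eK.injective ?_, ?_⟩
    · simpa using mem_center_iff.1 hz (eK a)
    · rw [← eK.orderOf_eq]
      simpa using hle
  · refine eO.injective (Subtype.ext ?_)
    simpa using mem_center_iff.1 (hOZ (eO b).2) (eO a)
  · rwa [Nat.card_congr eO.toEquiv]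
end

section
/- Let G be a finite group with α(G) = α(Z(G)). Then the quotient group G/Z(G) has exponent dividing 2; equivalently, x² ∈ Z(G) for every x ∈ G. -/
/-- The number of cyclic subgroups, as a sum over the possible generators. -/
theorem card_cyclic_subgroups_eq_sum (G : Type*) [Group G] [Fintype G] :
    (Nat.card {H : Subgroup G // IsCyclic H} : ℚ) = ∑ g : G, ((orderOf g).totient : ℚ)⁻¹ := by
  classical
  have := Fintype.ofFinite {H : Subgroup G // IsCyclic H}
  let f : G → {H : Subgroup G // IsCyclic H} := fun g => ⟨Subgroup.zpowers g, inferInstance⟩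
  rw [← Finset.sum_fiberwise (s := Finset.univ) (g := f), Nat.card_eq_fintype_card,
    ← Finset.card_univ, Finset.cast_card]
  refine Finset.sum_congr rfl fun ⟨H, hH⟩ _ => ?_
  obtain ⟨x, hx⟩ := (Subgroup.isCyclic_iff_exists_zpowers_eq_top H).1 hH
  have hpos : 0 < (orderOf x).totient := Nat.totient_pos.2 (orderOf_pos x)
  have hfib : ({g | f g = ⟨H, hH⟩} : Finset G) =
      ({y : H | orderOf y = Nat.card H} : Finset H).map ⟨_, Subtype.val_injective⟩ := by
    ext g
    simp only [f, Finset.mem_filter_univ, Subtype.mk.injEq, Finset.mem_map,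
      Function.Embedding.coeFn_mk, Subtype.exists]
    constructor
    · rintro rfl
      exact ⟨g, Subgroup.mem_zpowers g, by rw [Subgroup.orderOf_mk, Nat.card_zpowers], rfl⟩
    · rintro ⟨y, hy, ho, rfl⟩
      rw [Subgroup.orderOf_mk] at ho
      exact Subgroup.eq_of_le_of_card_ge (Subgroup.zpowers_le.2 hy)
        (by rw [Nat.card_zpowers, ho])
  have hcard : ({g | f g = ⟨H, hH⟩} : Finset G).card = (orderOf x).totient := by
    rw [hfib, Finset.card_map, IsCyclic.card_orderOf_eq_totient
      (by rw [Nat.card_eq_fintype_card]), ← Nat.card_zpowers x, hx]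
  have hord : ∀ g ∈ ({g | f g = ⟨H, hH⟩} : Finset G),
      ((orderOf g).totient : ℚ)⁻¹ = ((orderOf x).totient : ℚ)⁻¹ := by
    intro g hg
    have hg' : Subgroup.zpowers g = H := by simpa [f] using hg
    rw [← Nat.card_zpowers g, hg', ← Nat.card_zpowers x, hx]
  rw [Finset.sum_congr rfl hord, Finset.sum_const, hcard, nsmul_eq_mul,
    mul_inv_cancel₀ (by exact_mod_cast hpos.ne')]

/-- A coset of a central subgroup which contains commuting elements of orders `n` and `m`
contains an element whose order divides `gcd n m`. -/
theorem exists_orderOf_mul_dvd_gcd {G : Type*} [Group G] [Finite G] {Z : Subgroup G}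
    {x z : G} (hz : z ∈ Z) (hc : Commute x z) :
    ∃ w ∈ Z, orderOf (x * w) ∣ (orderOf x).gcd (orderOf (x * z)) := by
  set n := orderOf x
  set m := orderOf (x * z)
  have hg : 0 < n.gcd m := Nat.gcd_pos_of_pos_left _ (orderOf_pos x)
  obtain ⟨a, ha⟩ := Nat.gcd_dvd_left n m
  obtain ⟨b, hb⟩ := Nat.gcd_dvd_right n m
  have hbez := Nat.gcd_eq_gcd_ab n m
  set g := n.gcd m
  set u := n.gcdA m
  set v := n.gcdB m
  have hsum : (a : ℤ) * u + b * v = 1 := by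
    have hg' : (g : ℤ) ≠ 0 := by exact_mod_cast hg.ne'
    apply mul_left_cancel₀ hg'
    rw [ha, hb] at hbez
    push_cast at hbez
    linear_combination -hbez
  have hxy : Commute x (x * z) := (Commute.refl x).mul_right hc
  refine ⟨z ^ ((b : ℤ) * v), Z.zpow_mem hz _, orderOf_dvd_of_pow_eq_one ?_⟩
  have hw : x * z ^ ((b : ℤ) * v) = x ^ ((a : ℤ) * u) * (x * z) ^ ((b : ℤ) * v) := by
    rw [hc.mul_zpow, ← mul_assoc, ← zpow_add, hsum, zpow_one]
  have hx : (x ^ ((a : ℤ) * u)) ^ g = 1 := by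
    rw [← zpow_natCast, ← zpow_mul, show (a : ℤ) * u * g = (n : ℤ) * u by
      rw [ha]; push_cast; ring, zpow_mul, zpow_natCast, pow_orderOf_eq_one, one_zpow]
  have hy : ((x * z) ^ ((b : ℤ) * v)) ^ g = 1 := by
    rw [← zpow_natCast, ← zpow_mul, show (b : ℤ) * v * g = (m : ℤ) * v by
      rw [hb]; push_cast; ring, zpow_mul, zpow_natCast, pow_orderOf_eq_one, one_zpow]
  rw [hw, ((hxy.zpow_left _).zpow_right _).mul_pow, hx, hy, one_mul]

/-- Every coset of the center has an element whose order divides the order of every other. -/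
theorem exists_orderOf_dvd_of_mem_center {G : Type*} [Group G] [Finite G] (x : G) :
    ∃ w ∈ Subgroup.center G, ∀ z ∈ Subgroup.center G, orderOf (x * w) ∣ orderOf (x * w * z) := by
  obtain ⟨⟨w, hw⟩, hmin⟩ := Finite.exists_min fun w : Subgroup.center G => orderOf (x * w)
  refine ⟨w, hw, fun z hz => ?_⟩
  obtain ⟨t, ht, hd⟩ := exists_orderOf_mul_dvd_gcd hz (Subgroup.mem_center_iff.1 hz (x * w))
  have hle := hmin ⟨w * t, mul_mem hw ht⟩
  simp only [← mul_assoc] at hle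
  have heq : orderOf (x * w * t) = orderOf (x * w) :=
    (Nat.le_of_dvd (orderOf_pos _) (hd.trans (Nat.gcd_dvd_left _ _))).antisymm hle
  exact heq ▸ hd.trans (Nat.gcd_dvd_right _ _)

/-- If `orderOf x` divides the order of each element of its coset modulo the center, the orders
of the elements of the center divide those of the corresponding elements of the coset. -/
theorem orderOf_dvd_orderOf_mul_of_mem_center {G : Type*} [Group G] {x z : G}
    (hz : z ∈ Subgroup.center G) (h : orderOf x ∣ orderOf (x * z)) :
    orderOf z ∣ orderOf (x * z) := by
  have hc : Commute x z := Subgroup.mem_center_iff.1 hz x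
  have := (Commute.inv_left ((Commute.refl x).mul_right hc)).orderOf_mul_dvd_lcm
  rw [inv_mul_cancel_left, orderOf_inv] at this
  exact this.trans (Nat.lcm_dvd h dvd_rfl)

theorem sum_coset_center_le {G : Type*} [Group G] [Finite G] [Fintype (Subgroup.center G)]
    (x : G) :
    ∑ z : Subgroup.center G, ((orderOf (x * z)).totient : ℚ)⁻¹ ≤
        ∑ z : Subgroup.center G, ((orderOf z).totient : ℚ)⁻¹ ∧
      (∑ z : Subgroup.center G, ((orderOf (x * z)).totient : ℚ)⁻¹ =
        ∑ z : Subgroup.center G, ((orderOf z).totient : ℚ)⁻¹ → x ^ 2 ∈ Subgroup.center G) := by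
  obtain ⟨w, hw, hdvd⟩ := exists_orderOf_dvd_of_mem_center x
  have hshift : ∑ z : Subgroup.center G, ((orderOf (x * z)).totient : ℚ)⁻¹ =
      ∑ z : Subgroup.center G, ((orderOf (x * w * z)).totient : ℚ)⁻¹ := by
    rw [← Equiv.sum_comp (Equiv.mulLeft (⟨w, hw⟩ : Subgroup.center G))]
    simp [mul_assoc]
  have hterm : ∀ z ∈ (Finset.univ : Finset (Subgroup.center G)),
      ((orderOf (x * w * z)).totient : ℚ)⁻¹ ≤ ((orderOf z).totient : ℚ)⁻¹ := by
    rintro ⟨z, hz⟩ -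
    have hd := Nat.totient_dvd_of_dvd (orderOf_dvd_orderOf_mul_of_mem_center hz (hdvd z hz))
    rw [Subgroup.orderOf_mk]
    have hpos : 0 < (orderOf z).totient := Nat.totient_pos.2 (orderOf_pos z)
    have hle := Nat.le_of_dvd (Nat.totient_pos.2 (orderOf_pos (x * w * z))) hd
    gcongr
  rw [hshift]
  refine ⟨Finset.sum_le_sum hterm, fun heq => ?_⟩
  have h1 := (Finset.sum_eq_sum_iff_of_le hterm).1 heq 1 (Finset.mem_univ _)
  have h2 : (orderOf (x * w)).totient = 1 := by simpa using h1
  have hsq : (x * w) ^ 2 = 1 := by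
    apply orderOf_dvd_iff_pow_eq_one.1
    rcases Nat.totient_eq_one_iff.1 h2 with h | h <;> simp [h]
  have hc : Commute x w := Subgroup.mem_center_iff.1 hw x
  rw [hc.mul_pow] at hsq
  rw [eq_inv_of_mul_eq_one_left hsq]
  exact inv_mem (pow_mem hw 2)

/-- If `α(G) = α(Z(G))`, then `G/Z(G)` has exponent dividing 2; equivalently,
`x² ∈ Z(G)` for every `x ∈ G`. -/
theorem exponent_quotient_center_dvd_two (G : Type*) [Group G] [Finite G]
    (h : alpha G = alpha (Subgroup.center G)) :
    Monoid.exponent (G ⧸ Subgroup.center G) ∣ 2 ∧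
      ∀ x : G, x ^ 2 ∈ Subgroup.center G := by
  classical
  have := Fintype.ofFinite G
  have hsq : ∀ x : G, x ^ 2 ∈ Subgroup.center G := by
    have hG : (Nat.card G : ℚ) ≠ 0 := by exact_mod_cast Nat.card_pos.ne'
    have hZ : (Nat.card (Subgroup.center G) : ℚ) ≠ 0 := by exact_mod_cast Nat.card_pos.ne'
    rw [alpha, alpha, card_cyclic_subgroups_eq_sum, card_cyclic_subgroups_eq_sum,
      div_eq_div_iff hG hZ] at h
    have hdouble : ∑ x : G, ∑ z : Subgroup.center G, ((orderOf (x * z)).totient : ℚ)⁻¹ =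
        ∑ _x : G, ∑ z : Subgroup.center G, ((orderOf z).totient : ℚ)⁻¹ := by
      rw [Finset.sum_comm, Finset.sum_const, Finset.card_univ, nsmul_eq_mul,
        ← Nat.card_eq_fintype_card, mul_comm, ← h]
      have hz (z : Subgroup.center G) : ∑ x : G, ((orderOf (x * z)).totient : ℚ)⁻¹ =
          ∑ x : G, ((orderOf x).totient : ℚ)⁻¹ :=
        Equiv.sum_comp (Equiv.mulRight (z : G)) fun x => ((orderOf x).totient : ℚ)⁻¹
      rw [Finset.sum_congr rfl fun z _ => hz z, Finset.sum_const, Finset.card_univ,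
        nsmul_eq_mul, ← Nat.card_eq_fintype_card, mul_comm]
    exact fun x => (sum_coset_center_le x).2 <|
      (Finset.sum_eq_sum_iff_of_le fun x _ => (sum_coset_center_le x).1).1 hdouble x
        (Finset.mem_univ x)
  refine ⟨Monoid.exponent_dvd_of_forall_pow_eq_one fun q => ?_, hsq⟩
  induction q using QuotientGroup.induction_on with
  | H x => rw [← QuotientGroup.mk_pow, QuotientGroup.eq_one_iff]; exact hsq x
end

section
/- Let G be a finite group and a ∈ G. Then Σ_{x∈Z(G)} 1/φ(o(ax)) ≤ Σ_{x∈Z(G)} 1/φ(o(x)), where the sums are over all elements x of the center Z(G). -/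
/-- If `b` commutes with `z` and the order of `b` is minimal among the orders of the elements
`b * z ^ e`, then the order of `z` divides the order of `b * z`. -/
theorem orderOf_dvd_orderOf_mul_of_forall_le_s8 {G : Type*} [Group G] [Finite G] {b z : G}
    (hbz : Commute b z) (hmin : ∀ e : ℤ, orderOf b ≤ orderOf (b * z ^ e)) :
    orderOf z ∣ orderOf (b * z) := by
  rw [Nat.dvd_iff_prime_pow_dvd_dvd]
  intro p k hp hk
  obtain ⟨J, M, hpM, hn⟩ := Nat.exists_eq_pow_mul_and_not_dvd
    (Nat.card_pos (α := G)).ne' p hp.ne_one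
  obtain ⟨i, u, hpu, hi⟩ := Nat.exists_eq_pow_mul_and_not_dvd
    (orderOf_pos (b * z)).ne' p hp.ne_one
  obtain ⟨j, m, hpm, hj⟩ := Nat.exists_eq_pow_mul_and_not_dvd
    (orderOf_pos b).ne' p hp.ne_one
  have hcop : ∀ {t : ℕ}, ¬ p ∣ t → ∀ r, Nat.Coprime t (p ^ r) := fun h r =>
    (((Nat.Prime.coprime_iff_not_dvd hp).2 h).pow_left r).symm
  have huM : u ∣ M := (hcop hpu J).dvd_of_dvd_mul_left
    (hn ▸ (Dvd.intro_left _ hi.symm).trans (orderOf_dvd_natCard _))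
  have hmM : m ∣ M := (hcop hpm J).dvd_of_dvd_mul_left
    (hn ▸ (Dvd.intro_left _ hj.symm).trans (orderOf_dvd_natCard _))
  have hjJ : p ^ j ∣ p ^ J := (hcop hpM j).symm.dvd_of_dvd_mul_right
    (hn ▸ (Dvd.intro _ hj.symm).trans (orderOf_dvd_natCard _))
  have hm0 : 0 < m := Nat.pos_of_ne_zero fun h => hpm (h ▸ dvd_zero p)
  obtain ⟨s, t, hst⟩ := Int.isCoprime_iff_gcd_eq_one.2
    (show Int.gcd (M : ℤ) ((p ^ J : ℕ) : ℤ) = 1 from hcop hpM J)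
  have hb' : b * z ^ (s * M) = b ^ (t * (p ^ J : ℕ)) * (b * z) ^ (s * M) := by
    rw [hbz.mul_zpow, ← mul_assoc, ← zpow_add, add_comm, hst, zpow_one]
  have hcomm : Commute (b ^ (t * (p ^ J : ℕ))) ((b * z) ^ (s * M)) :=
    ((Commute.refl b).mul_right hbz).zpow_zpow _ _
  have hdvd : orderOf (b * z ^ (s * M)) ∣ p ^ i * m := by
    rw [orderOf_dvd_iff_pow_eq_one, hb', hcomm.mul_pow, ← zpow_natCast, ← zpow_natCast,
      ← zpow_mul, ← zpow_mul, orderOf_dvd_iff_zpow_eq_one.1, orderOf_dvd_iff_zpow_eq_one.1, one_mul]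
    · rw [hi, mul_assoc]
      refine Dvd.dvd.mul_left ?_ s
      rw [← Nat.cast_mul, Int.natCast_dvd_natCast, mul_comm]
      exact mul_dvd_mul huM (dvd_mul_right _ _)
    · rw [hj, mul_assoc]
      refine Dvd.dvd.mul_left ?_ t
      rw [← Nat.cast_mul, Int.natCast_dvd_natCast]
      exact mul_dvd_mul hjJ (dvd_mul_left _ _)
  have hji : j ≤ i := by
    have h := (hmin _).trans (Nat.le_of_dvd (by have := hp.pos; positivity) hdvd)
    rw [hj] at h
    exact (Nat.pow_le_pow_iff_right hp.one_lt).1 (Nat.le_of_mul_le_mul_right h hm0)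
  have hz : orderOf z ∣ p ^ i * M := by
    have h₁ : b ^ (p ^ i * M) = 1 := orderOf_dvd_iff_pow_eq_one.1
      (hj ▸ mul_dvd_mul (pow_dvd_pow p hji) hmM)
    have h₂ : (b * z) ^ (p ^ i * M) = 1 := orderOf_dvd_iff_pow_eq_one.1
      (hi ▸ mul_dvd_mul_left _ huM)
    rw [hbz.mul_pow, h₁, one_mul] at h₂
    exact orderOf_dvd_of_pow_eq_one h₂
  exact ((hcop hpM k).symm.dvd_of_dvd_mul_right (hk.trans hz)).trans (Dvd.intro _ hi.symm)

/-- For a finite group `G` and `a ∈ G`,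
`Σ_{x ∈ Z(G)} 1/φ(o(ax)) ≤ Σ_{x ∈ Z(G)} 1/φ(o(x))`. -/
theorem sum_inv_totient_coset_le (G : Type*) [Group G] [Fintype G] [DecidableEq G] (a : G) :
    ∑ x : Subgroup.center G, (1 : ℚ) / (Nat.totient (orderOf (a * (x : G))) : ℚ) ≤
      ∑ x : Subgroup.center G, (1 : ℚ) / (Nat.totient (orderOf (x : G)) : ℚ) := by
  obtain ⟨c, hc⟩ := Finite.exists_min fun x : Subgroup.center G => orderOf (a * (x : G))
  rw [← Equiv.sum_comp (Equiv.mulLeft c) fun x : Subgroup.center G =>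
    (1 : ℚ) / (Nat.totient (orderOf (a * (x : G))) : ℚ)]
  refine Finset.sum_le_sum fun z _ => ?_
  have hdvd : orderOf (z : G) ∣ orderOf (a * c * (z : G)) :=
    orderOf_dvd_orderOf_mul_of_forall_le_s8 (Subgroup.mem_center_iff.1 z.2 (a * c)) fun e => by
      simpa [mul_assoc] using hc (c * z ^ e)
  rw [Equiv.coe_mulLeft, Subgroup.coe_mul, ← mul_assoc]
  exact one_div_le_one_div_of_le (Nat.cast_pos.2 (Nat.totient_pos.2 (orderOf_pos _)))
    (Nat.cast_le.2 (Nat.le_of_dvd (Nat.totient_pos.2 (orderOf_pos _))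
      (Nat.totient_dvd_of_dvd hdvd)))
end

section
/- Let G be a finite group, y ∈ G an element whose order k = o(y) is minimal among the orders of elements of the coset yZ(G), and x ∈ Z(G). Then o(yx) = (k/gcd(k, o(x))) · o(x); in particular, o(x) divides o(yx). -/
/-- An element of minimal order in its coset modulo the center has order dividing that of every
element of the coset. -/
theorem orderOf_dvd_orderOf_mul_of_min_order {G : Type*} [Group G] [Finite G] {y : G}
    (hy : ∀ z ∈ Subgroup.center G, orderOf y ≤ orderOf (y * z))
    {x : G} (hx : x ∈ Subgroup.center G) : orderOf y ∣ orderOf (y * x) := by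
  set k := orderOf y with hk
  set m := orderOf (y * x) with hm
  have hcomm : Commute y x := Subgroup.mem_center_iff.mp hx y
  have hkpos : 0 < k := orderOf_pos y
  have hdpos : 0 < k.gcd m := Nat.gcd_pos_of_pos_left m hkpos
  obtain ⟨c, hc⟩ := Nat.gcd_dvd_right k m
  have hbez : ((k.gcd m : ℕ) : ℤ) = k * k.gcdA m + m * k.gcdB m := Nat.gcd_eq_gcd_ab k m
  have hpow : (y * x ^ ((c : ℤ) * k.gcdB m)) ^ k.gcd m = 1 := by
    have hyd : y ^ k.gcd m = y ^ ((m : ℤ) * k.gcdB m) := by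
      rw [← zpow_natCast, hbez, zpow_add, zpow_mul y (k : ℤ), zpow_natCast, hk,
        pow_orderOf_eq_one, one_zpow, one_mul]
    have hxd : (x ^ ((c : ℤ) * k.gcdB m)) ^ k.gcd m = x ^ ((m : ℤ) * k.gcdB m) := by
      rw [← zpow_natCast, ← zpow_mul]
      congr 1
      have : (m : ℤ) = (k.gcd m : ℕ) * c := by exact_mod_cast hc
      linear_combination (-k.gcdB m) * this
    rw [(hcomm.zpow_right _).mul_pow, hyd, hxd, ← hcomm.mul_zpow, zpow_mul, zpow_natCast, hm,
      pow_orderOf_eq_one, one_zpow]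
  have hle : k ≤ k.gcd m :=
    (hy _ (Subgroup.zpow_mem _ hx _)).trans (orderOf_le_of_pow_eq_one hdpos hpow)
  exact Nat.gcd_eq_left_iff_dvd.mp (le_antisymm (Nat.gcd_le_left m hkpos) hle)

/-- If `y ∈ G` has minimal order `k` among the elements of the coset `yZ(G)` and
`x ∈ Z(G)`, then `o(yx) = (k / gcd(k, o(x))) · o(x)`; in particular `o(x) ∣ o(yx)`. -/
theorem orderOf_mul_of_min_order (G : Type*) [Group G] [Finite G] (y : G)
    (hy : ∀ z ∈ Subgroup.center G, orderOf y ≤ orderOf (y * z))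
    (x : G) (hx : x ∈ Subgroup.center G) :
    orderOf (y * x) = (orderOf y / Nat.gcd (orderOf y) (orderOf x)) * orderOf x ∧
      orderOf x ∣ orderOf (y * x) := by
  have hcomm : Commute y x := Subgroup.mem_center_iff.mp hx y
  have hydvd := orderOf_dvd_orderOf_mul_of_min_order hy hx
  have hxdvd : orderOf x ∣ orderOf (y * x) := by
    have h := pow_orderOf_eq_one (y * x)
    rw [hcomm.mul_pow, orderOf_dvd_iff_pow_eq_one.mp hydvd, one_mul] at h
    exact orderOf_dvd_of_pow_eq_one h
  refine ⟨?_, hxdvd⟩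
  rw [Nat.div_mul_right_comm (Nat.gcd_dvd_left _ _)]
  exact Nat.dvd_antisymm hcomm.orderOf_mul_dvd_lcm (Nat.lcm_dvd hydvd hxdvd)
end

section
/- Let G be a finite group such that the quotient G/Z(G) is an elementary abelian 2-group. Then G is isomorphic to a direct product G₁ × G₂, where G₁ is a 2-group and G₂ is an abelian group of odd order. -/
/-- A group generated by two complementary subgroups, one of which is central, is their direct
product. -/
noncomputable def Subgroup.IsComplement'.prodMulEquivOfLeCenter {G : Type*} [Group G]
    {H K : Subgroup G} (h : H.IsComplement' K) (hK : K ≤ Subgroup.center G) : H × K ≃* G :=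
  MulEquiv.ofBijective
    (H.subtype.noncommCoprod K.subtype fun x y => (Subgroup.mem_center_iff.mp (hK y.2) x)) h

/-- An element of odd order whose square lies in a subgroup lies in that subgroup. -/
theorem Subgroup.mem_of_sq_mem_of_odd_orderOf {G : Type*} [Group G] {H : Subgroup G} {g : G}
    (hg : g ^ 2 ∈ H) (hodd : Odd (orderOf g)) : g ∈ H := by
  obtain ⟨m, hm⟩ := exists_pow_eq_self_of_coprime hodd.coprime_two_left
  exact hm ▸ H.pow_mem hg m

/-- If `G/Z(G)` is an elementary abelian 2-group, then `G ≅ G₁ × G₂` where `G₁` is a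
2-group and `G₂` is an abelian group of odd order. -/
theorem prod_decomposition_of_quotient_center (G : Type*) [Group G] [Finite G]
    (hab : ∀ a b : G ⧸ Subgroup.center G, a * b = b * a)
    (hord : ∀ g : G ⧸ Subgroup.center G, g ≠ 1 → orderOf g = 2) :
    ∃ (G₁ : Type) (_ : Group G₁) (G₂ : Type) (_ : Group G₂),
      Finite G₁ ∧ IsPGroup 2 G₁ ∧
      Finite G₂ ∧ (∀ a b : G₂, a * b = b * a) ∧ Odd (Nat.card G₂) ∧
      Nonempty (G ≃* G₁ × G₂) := by
  have hsq (g : G ⧸ Subgroup.center G) : g ^ 2 = 1 := by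
    by_cases hg : g = 1
    · simp [hg]
    · exact hord g hg ▸ pow_orderOf_eq_one g
  have hsq_mem (g : G) : g ^ 2 ∈ Subgroup.center G :=
    (QuotientGroup.eq_one_iff _).mp (hsq g)
  have hp : IsPGroup 2 (G ⧸ Subgroup.center G) := fun g => ⟨1, by simpa using hsq g⟩
  have hnil : Group.IsNilpotent G := Group.of_quotient_center_nilpotent hp.isNilpotent
  let P : Sylow 2 G := default
  have hP : (P : Subgroup G).Normal := inferInstance
  obtain ⟨K, hK⟩ := Subgroup.exists_right_complement'_of_coprime P.card_coprime_index
  have hKodd : Odd (Nat.card K) := by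
    rw [← hK.symm.index_eq_card, Nat.odd_iff, ← Nat.two_dvd_ne_zero]
    exact P.not_dvd_index
  have hKcenter : K ≤ Subgroup.center G := fun k hk =>
    Subgroup.mem_of_sq_mem_of_odd_orderOf (hsq_mem k)
      (hKodd.of_dvd_nat (K.orderOf_dvd_natCard hk))
  obtain ⟨G₁, _, _, ⟨e₁⟩⟩ := Finite.exists_type_univ_nonempty_mulEquiv.{_, 0} P
  obtain ⟨G₂, _, _, ⟨e₂⟩⟩ := Finite.exists_type_univ_nonempty_mulEquiv.{_, 0} K
  refine ⟨G₁, inferInstance, G₂, inferInstance, inferInstance, P.isPGroup'.of_equiv e₁,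
    inferInstance, fun a b => ?_, ?_,
    ⟨(hK.prodMulEquivOfLeCenter hKcenter).symm.trans (e₁.prodCongr e₂)⟩⟩
  · apply e₂.symm.injective
    rw [map_mul, map_mul]
    exact Subtype.ext (Subgroup.mem_center_iff.mp (hKcenter (e₂.symm b).2) _)
  · rwa [← Nat.card_congr e₂.toEquiv]
end
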